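/- For every α ∈ (0,1), A > 0 and k ∈ [0,1) there exists R₀ > 0 with the following property: if 0 < R ≤ R₀ and μ : ℂ → ℂ is Hölder continuous with exponent α and constant A, has compact support contained in B(0,R), satisfies μ(0) = 0 and ‖μ‖_∞ ≤ k, then there exists a C¹ map f : B(0,R) → ℂ solving the Beltrami equation ∂_z̄ f = μ ∂_z f on B(0,R), whose Jacobian J_f = |∂_z f|² − |∂_z̄ f|² is everywhere positive, and which is a homeomorphism onto its image. -/

import Mathlib

open MeasureTheory Complex ENNReal NNReal Metric Set Filter

/-- The Wirtinger derivative `∂_z f = (∂_x f - i ∂_y f)/2` of `f : ℂ → ℂ`,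
computed from the real Fréchet derivative. -/
noncomputable def dZ (f : ℂ → ℂ) (z : ℂ) : ℂ :=
  (fderiv ℝ f z 1 - Complex.I * fderiv ℝ f z Complex.I) / 2

/-- The Wirtinger derivative `∂_z̄ f = (∂_x f + i ∂_y f)/2` of `f : ℂ → ℂ`. -/
noncomputable def dZbar (f : ℂ → ℂ) (z : ℂ) : ℂ :=
  (fderiv ℝ f z 1 + Complex.I * fderiv ℝ f z Complex.I) / 2

/-- `g` is the weak (distributional) Wirtinger derivative `∂_z u`, defined by testing
against smooth compactly supported functions: `∫ u ∂_z φ = -∫ g φ`. -/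
def HasWeakDz (u g : ℂ → ℂ) : Prop :=
  ∀ φ : ℂ → ℂ, ContDiff ℝ (⊤ : ℕ∞) φ → HasCompactSupport φ →
    (∫ z : ℂ, u z * dZ φ z) = - ∫ z : ℂ, g z * φ z

/-- `g` is the weak (distributional) Wirtinger derivative `∂_z̄ u`. -/
def HasWeakDzbar (u g : ℂ → ℂ) : Prop :=
  ∀ φ : ℂ → ℂ, ContDiff ℝ (⊤ : ℕ∞) φ → HasCompactSupport φ →
    (∫ z : ℂ, u z * dZbar φ z) = - ∫ z : ℂ, g z * φ z

/-- The real-linear map `v ↦ a v + b v̄`. -/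
noncomputable def wirtingerCLM (a b : ℂ) : ℂ →L[ℝ] ℂ :=
  a • ContinuousLinearMap.id ℝ ℂ + b • (Complex.conjCLE : ℂ →L[ℝ] ℂ)

@[simp]
theorem wirtingerCLM_apply (a b v : ℂ) :
    wirtingerCLM a b v = a * v + b * (starRingEnd ℂ) v := by
  simp [wirtingerCLM]

theorem norm_wirtingerCLM_le (a b : ℂ) : ‖wirtingerCLM a b‖ ≤ ‖a‖ + ‖b‖ := by
  refine ContinuousLinearMap.opNorm_le_bound _ (by positivity) fun v => ?_
  rw [wirtingerCLM_apply]
  refine (norm_add_le _ _).trans ?_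
  simp [add_mul]

theorem continuous_wirtingerCLM : Continuous fun p : ℂ × ℂ => wirtingerCLM p.1 p.2 := by
  unfold wirtingerCLM
  fun_prop

theorem dZ_eq_of_hasFDerivAt {f : ℂ → ℂ} {a b z : ℂ}
    (hf : HasFDerivAt f (wirtingerCLM a b) z) : dZ f z = a := by
  rw [dZ, hf.fderiv]
  simp only [wirtingerCLM_apply, map_one, Complex.conj_I]
  linear_combination (b - a) / 2 * Complex.I_mul_I

theorem dZbar_eq_of_hasFDerivAt {f : ℂ → ℂ} {a b z : ℂ}
    (hf : HasFDerivAt f (wirtingerCLM a b) z) : dZbar f z = b := by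
  rw [dZbar, hf.fderiv]
  simp only [wirtingerCLM_apply, map_one, Complex.conj_I]
  linear_combination (a - b) / 2 * Complex.I_mul_I

/-! ### Gaussian moments on the plane -/

theorem integral_norm_rpow_mul_gaussian {q b : ℝ} (hq : -2 < q) (hb : 0 < b) :
    ∫ u : ℂ, ‖u‖ ^ q * Real.exp (-(b * ‖u‖ ^ 2)) =
      Real.pi * Real.Gamma (1 + q / 2) * b ^ (-(1 + q / 2)) := by
  have h := Complex.integral_rpow_mul_exp_neg_mul_rpow (p := 2) (by norm_num) hq hb
  simp only [Real.rpow_two, neg_mul] at h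
  rw [h, show -(q + 2) / 2 = -(1 + q / 2) by ring, show (q + 2) / 2 = 1 + q / 2 by ring]
  ring

theorem integrable_norm_rpow_mul_gaussian {q b : ℝ} (hq : -2 < q) (hb : 0 < b) :
    Integrable fun u : ℂ => ‖u‖ ^ q * Real.exp (-(b * ‖u‖ ^ 2)) := by
  refine Integrable.of_integral_ne_zero ?_
  rw [integral_norm_rpow_mul_gaussian hq hb]
  have : 0 < Real.Gamma (1 + q / 2) := Real.Gamma_pos_of_pos (by linarith)
  positivity

theorem integral_gaussian_plane {b : ℝ} (hb : 0 < b) :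
    ∫ u : ℂ, Real.exp (-(b * ‖u‖ ^ 2)) = Real.pi / b := by
  have h := integral_norm_rpow_mul_gaussian (q := 0) (by norm_num) hb
  simp only [Real.rpow_zero, one_mul, zero_div, add_zero, Real.Gamma_one, mul_one,
    Real.rpow_neg_one] at h
  rw [h, div_eq_mul_inv]

theorem integrable_gaussian_plane {b : ℝ} (hb : 0 < b) :
    Integrable fun u : ℂ => Real.exp (-(b * ‖u‖ ^ 2)) := by
  simpa using integrable_norm_rpow_mul_gaussian (q := 0) (by norm_num) hb

theorem integral_norm_sq_mul_gaussian {b : ℝ} (hb : 0 < b) :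
    ∫ u : ℂ, ‖u‖ ^ 2 * Real.exp (-(b * ‖u‖ ^ 2)) = Real.pi / b ^ 2 := by
  have h := integral_norm_rpow_mul_gaussian (q := 2) (by norm_num) hb
  simp only [Real.rpow_two] at h
  rw [h, show (1 + 2 / 2 : ℝ) = 2 by norm_num, Real.Gamma_two, Real.rpow_neg hb.le, Real.rpow_two]
  ring

theorem integrable_norm_sq_mul_gaussian {b : ℝ} (hb : 0 < b) :
    Integrable fun u : ℂ => ‖u‖ ^ 2 * Real.exp (-(b * ‖u‖ ^ 2)) := by
  simpa using integrable_norm_rpow_mul_gaussian (q := 2) (by norm_num) hb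

/-! ### Convolution of a Hölder function with a Gaussian-dominated kernel -/

/-- The convolution `∫ h(w) K(z - w) dw`. -/
noncomputable def kernelConv (h K : ℂ → ℂ) (z : ℂ) : ℂ := ∫ w, h w * K (z - w)

theorem norm_kernelConv_sub_le {α M b C : ℝ} {h K : ℂ → ℂ} (hα : 0 < α)
    (hh : ∀ z w, ‖h z - h w‖ ≤ M * ‖z - w‖ ^ α) (hc : Continuous h) (hs : HasCompactSupport h)
    (hK : Continuous K) (hb : 0 < b) (hC : ∀ u, ‖K u‖ ≤ C * Real.exp (-(b * ‖u‖ ^ 2))) (z : ℂ) :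
    ‖kernelConv h K z - h z * ∫ u, K u‖ ≤
      M * C * (Real.pi * Real.Gamma (1 + α / 2) * b ^ (-(1 + α / 2))) := by
  have hKint : Integrable K :=
    ((integrable_gaussian_plane hb).const_mul C).mono' hK.aestronglyMeasurable
      (Eventually.of_forall hC)
  have h1 : kernelConv h K z = ∫ u, h (z - u) * K u := by
    rw [← integral_sub_left_eq_self _ _ z]
    simp [kernelConv]
  have h_integrable : Integrable fun u => h (z - u) * K u := by
    refine Continuous.integrable_of_hasCompactSupport (by fun_prop) ?_
    exact (hs.comp_homeomorph (Homeomorph.subLeft z)).mul_right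
  rw [h1, ← integral_const_mul, ← integral_sub h_integrable (hKint.const_mul _),
    ← integral_norm_rpow_mul_gaussian (by linarith) hb, ← integral_const_mul]
  refine norm_integral_le_of_norm_le
    ((integrable_norm_rpow_mul_gaussian (by linarith) hb).const_mul _)
    (Eventually.of_forall fun u => ?_)
  have h2 := hh (z - u) z
  rw [show z - u - z = -u by ring, norm_neg] at h2
  rw [← sub_mul, norm_mul]
  calc _ ≤ (M * ‖u‖ ^ α) * (C * Real.exp (-(b * ‖u‖ ^ 2))) :=
        mul_le_mul h2 (hC u) (norm_nonneg _) ((norm_nonneg _).trans h2)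
    _ = _ := by ring

theorem norm_kernelConv_le {h K : ℂ → ℂ} (hc : Continuous h) (hs : HasCompactSupport h) {B : ℝ}
    (hB : ∀ u, ‖K u‖ ≤ B) (z : ℂ) : ‖kernelConv h K z‖ ≤ (∫ w, ‖h w‖) * B := by
  rw [← integral_mul_const]
  refine norm_integral_le_of_norm_le
    ((hc.integrable_of_hasCompactSupport hs).norm.mul_const _) (Eventually.of_forall fun w => ?_)
  rw [norm_mul]
  exact mul_le_mul_of_nonneg_left (hB _) (norm_nonneg _)

/-! ### The kernels -/

/-- The kernel `s ū² exp(-s|u|²)`; up to sign it is the `z`-derivative of `kerP s`. -/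
noncomputable def kerZ (s : ℝ) (u : ℂ) : ℂ :=
  ((s * Real.exp (-(s * ‖u‖ ^ 2)) : ℝ) : ℂ) * (starRingEnd ℂ) u ^ 2

/-- The kernel `(1 - s|u|²) exp(-s|u|²)`, which is the `z̄`-derivative of `kerP s`. -/
noncomputable def kerZbar (s : ℝ) (u : ℂ) : ℂ :=
  (((1 - s * ‖u‖ ^ 2) * Real.exp (-(s * ‖u‖ ^ 2)) : ℝ) : ℂ)

/-- The kernel `ū exp(-s|u|²)`; its integral over `s > 0` is `1 / u`. -/
noncomputable def kerP (s : ℝ) (u : ℂ) : ℂ :=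
  ((Real.exp (-(s * ‖u‖ ^ 2)) : ℝ) : ℂ) * (starRingEnd ℂ) u

theorem continuous_kerZ : Continuous fun p : ℝ × ℂ => kerZ p.1 p.2 := by
  unfold kerZ
  fun_prop

theorem continuous_kerZbar : Continuous fun p : ℝ × ℂ => kerZbar p.1 p.2 := by
  unfold kerZbar
  fun_prop

theorem continuous_kerP : Continuous fun p : ℝ × ℂ => kerP p.1 p.2 := by
  unfold kerP
  fun_prop

theorem exp_neg_eq_half_mul (x : ℝ) : Real.exp (-x) = Real.exp (-(x / 2)) * Real.exp (-(x / 2)) := by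
  rw [← Real.exp_add]
  ring_nf

theorem one_add_mul_exp_neg_le (x : ℝ) :
    (1 + x) * Real.exp (-x) ≤ 2 * Real.exp (-(x / 2)) := by
  have h1 := Real.add_one_le_exp (x / 2)
  have h2 : Real.exp (x / 2) * Real.exp (-(x / 2)) = 1 := by rw [← Real.exp_add]; simp
  have h3 := Real.exp_pos (-(x / 2))
  rw [exp_neg_eq_half_mul, ← mul_assoc]
  refine mul_le_mul_of_nonneg_right ?_ h3.le
  nlinarith

theorem norm_kerZ_le {s : ℝ} (hs : 0 ≤ s) (u : ℂ) :
    ‖kerZ s u‖ ≤ 2 * Real.exp (-(s / 2 * ‖u‖ ^ 2)) := by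
  have h := one_add_mul_exp_neg_le (s * ‖u‖ ^ 2)
  have h0 := Real.exp_pos (-(s * ‖u‖ ^ 2))
  rw [kerZ, norm_mul, Complex.norm_real, norm_pow, RCLike.norm_conj, Real.norm_of_nonneg (by positivity),
    show s / 2 * ‖u‖ ^ 2 = s * ‖u‖ ^ 2 / 2 by ring]
  nlinarith

theorem norm_kerZbar_le {s : ℝ} (hs : 0 ≤ s) (u : ℂ) :
    ‖kerZbar s u‖ ≤ 2 * Real.exp (-(s / 2 * ‖u‖ ^ 2)) := by
  have hx : 0 ≤ s * ‖u‖ ^ 2 := by positivity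
  have h := one_add_mul_exp_neg_le (s * ‖u‖ ^ 2)
  have h0 := Real.exp_pos (-(s * ‖u‖ ^ 2))
  rw [kerZbar, Complex.norm_real, norm_mul, Real.norm_of_nonneg h0.le,
    show s / 2 * ‖u‖ ^ 2 = s * ‖u‖ ^ 2 / 2 by ring]
  refine le_trans (mul_le_mul_of_nonneg_right ?_ h0.le) h
  rw [Real.norm_eq_abs, abs_le]
  constructor <;> linarith

theorem integral_kerZ (s : ℝ) : ∫ u, kerZ s u = 0 := by
  let e := rotation ⟨Complex.I, by simp [Submonoid.unitSphere]⟩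
  have h := e.measurePreserving.integral_comp e.toHomeomorph.measurableEmbedding (kerZ s)
  have h1 : ∀ u, kerZ s (e u) = -kerZ s u := fun u => by
    have : e u = Complex.I * u := rfl
    simp only [this, kerZ, norm_mul, Complex.norm_I, one_mul, map_mul, Complex.conj_I, mul_pow,
      neg_sq, Complex.I_sq]
    ring
  simp_rw [h1, integral_neg] at h
  linear_combination -h / 2

theorem integral_kerZbar {s : ℝ} (hs : 0 < s) : ∫ u, kerZbar s u = 0 := by
  unfold kerZbar
  rw [integral_complex_ofReal]
  have : ∀ u : ℂ, (1 - s * ‖u‖ ^ 2) * Real.exp (-(s * ‖u‖ ^ 2)) =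
    Real.exp (-(s * ‖u‖ ^ 2)) - s * (‖u‖ ^ 2 * Real.exp (-(s * ‖u‖ ^ 2))) := fun u => by ring
  simp_rw [this]
  rw [integral_sub (integrable_gaussian_plane hs)
    ((integrable_norm_sq_mul_gaussian hs).const_mul _), integral_const_mul,
    integral_gaussian_plane hs, integral_norm_sq_mul_gaussian hs]
  norm_cast
  field_simp
  ring

theorem hasFDerivAt_kerP (s : ℝ) (u : ℂ) :
    HasFDerivAt (kerP s) (wirtingerCLM (-kerZ s u) (kerZbar s u)) u := by
  have h1 : HasFDerivAt (fun u : ℂ => ‖u‖ ^ 2) (2 • innerSL ℝ u) u :=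
    (hasStrictFDerivAt_norm_sq u).hasFDerivAt
  have h2 := ((h1.const_mul s).neg.exp)
  have h3 : HasFDerivAt (fun u : ℂ => ((Real.exp (-(s * ‖u‖ ^ 2)) : ℝ) : ℂ)) _ u :=
    Complex.ofRealCLM.hasFDerivAt.comp u h2
  have h4 := h3.mul (Complex.conjCLE : ℂ →L[ℝ] ℂ).hasFDerivAt
  refine h4.congr_fderiv ?_
  ext v
  have h5 : ((inner ℝ u v : ℝ) : ℂ) = ((starRingEnd ℂ) u * v + u * (starRingEnd ℂ) v) / 2 := by
    rw [Complex.inner, Complex.re_eq_add_conj]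
    simp [mul_comm, add_comm]
  have h6 : ((‖u‖ : ℝ) : ℂ) ^ 2 = (starRingEnd ℂ) u * u := (Complex.conj_mul' u).symm
  simp [kerZ, kerZbar, h5, -Complex.ofReal_exp, -Complex.inner]
  rw [h6]
  ring

theorem hasFDerivAt_integral_mul_of_hasCompactSupport {E : Type*} [NormedAddCommGroup E]
    [NormedSpace ℝ E] [ProperSpace E] {h : ℂ → ℂ} (hc : Continuous h) (hs : HasCompactSupport h)
    {φ : E → ℂ → ℂ} {φ' : E → ℂ → E →L[ℝ] ℂ} (hφ : Continuous fun p : E × ℂ => φ p.1 p.2)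
    (hφ' : Continuous fun p : E × ℂ => φ' p.1 p.2)
    (hd : ∀ x w, HasFDerivAt (fun y => φ y w) (φ' x w) x) (x : E) :
    HasFDerivAt (fun y => ∫ w, h w * φ y w) (∫ w, h w • φ' x w) x := by
  obtain ⟨B, hB⟩ := ((isCompact_closedBall x 1).prod hs).exists_bound_of_continuousOn
    hφ'.continuousOn
  have hφx : ∀ y, Continuous fun w => φ y w := fun y => hφ.comp (Continuous.prodMk_right y)
  have hφx' : ∀ y, Continuous fun w => φ' y w := fun y => hφ'.comp (Continuous.prodMk_right y)
  refine hasFDerivAt_integral_of_dominated_of_fderiv_le (bound := fun w => ‖h w‖ * B)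
    (Metric.closedBall_mem_nhds x one_pos)
    (Eventually.of_forall fun y => (hc.mul (hφx y)).aestronglyMeasurable)
    ((hc.mul (hφx x)).integrable_of_hasCompactSupport hs.mul_right)
    (hc.smul (hφx' x)).aestronglyMeasurable
    (Eventually.of_forall fun w y hy => ?_)
    ((hc.integrable_of_hasCompactSupport hs).norm.mul_const _)
    (Eventually.of_forall fun w y _ => (hd y w).const_mul (h w))
  rw [norm_smul]
  by_cases hw : w ∈ tsupport h
  · exact mul_le_mul_of_nonneg_left (hB (y, w) ⟨hy, hw⟩) (norm_nonneg _)
  · simp [image_eq_zero_of_notMem_tsupport hw]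

theorem integrable_mul_kernel {h K : ℂ → ℂ} (hc : Continuous h) (hs : HasCompactSupport h)
    (hK : Continuous K) (z : ℂ) : Integrable fun w => h w * K (z - w) :=
  Continuous.integrable_of_hasCompactSupport (by fun_prop) hs.mul_right

theorem hasFDerivAt_kernelConv_kerP {h : ℂ → ℂ} (hc : Continuous h) (hs : HasCompactSupport h)
    (s : ℝ) (z : ℂ) :
    HasFDerivAt (kernelConv h (kerP s))
      (wirtingerCLM (-kernelConv h (kerZ s) z) (kernelConv h (kerZbar s) z)) z := by
  have hZ : Continuous (kerZ s) := continuous_kerZ.comp (Continuous.prodMk_right s)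
  have hZb : Continuous (kerZbar s) := continuous_kerZbar.comp (Continuous.prodMk_right s)
  have hP : Continuous (kerP s) := continuous_kerP.comp (Continuous.prodMk_right s)
  have hd := hasFDerivAt_integral_mul_of_hasCompactSupport hc hs
    (φ := fun z w => kerP s (z - w))
    (φ' := fun z w => wirtingerCLM (-kerZ s (z - w)) (kerZbar s (z - w)))
    (hP.comp (continuous_fst.sub continuous_snd))
    (continuous_wirtingerCLM.comp ((hZ.comp (continuous_fst.sub continuous_snd)).neg.prodMk
      (hZb.comp (continuous_fst.sub continuous_snd))))
    (fun z w => (hasFDerivAt_comp_sub w).2 (hasFDerivAt_kerP s (z - w))) z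
  refine hd.congr_fderiv ?_
  have hi1 : Integrable fun w => -(h w * kerZ s (z - w)) := (integrable_mul_kernel hc hs hZ z).neg
  have hi2 := integrable_mul_kernel hc hs hZb z
  have he : ∀ w, h w • wirtingerCLM (-kerZ s (z - w)) (kerZbar s (z - w)) =
      (-(h w * kerZ s (z - w))) • ContinuousLinearMap.id ℝ ℂ +
        (h w * kerZbar s (z - w)) • (Complex.conjCLE : ℂ →L[ℝ] ℂ) := fun w => by
    rw [wirtingerCLM, smul_add, smul_smul, smul_smul, mul_neg]
  simp_rw [he]
  rw [integral_add (hi1.smul_const _) (hi2.smul_const _), integral_smul_const, integral_smul_const,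
    integral_neg]
  rfl

theorem continuous_kernelConv_uncurry {h : ℂ → ℂ} (hc : Continuous h) (hs : HasCompactSupport h)
    {K : ℝ → ℂ → ℂ} (hK : Continuous fun p : ℝ × ℂ => K p.1 p.2) :
    Continuous fun p : ℝ × ℂ => kernelConv h (K p.1) p.2 := by
  have h1 : Continuous (fun p : ℝ × ℂ => ∫ w in tsupport h, h w * K p.1 (p.2 - w)) := by
    refine continuous_parametric_integral_of_continuous ?_ hs
    exact (hc.comp continuous_snd).mul (hK.comp
      (f := fun q : (ℝ × ℂ) × ℂ => (q.1.1, q.1.2 - q.2)) (by fun_prop))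
  convert h1 using 2 with p
  rw [kernelConv, setIntegral_eq_integral_of_forall_compl_eq_zero]
  intro w hw
  simp [image_eq_zero_of_notMem_tsupport hw]

theorem abs_exp_neg_sub_exp_neg_le (p q : ℝ) :
    |Real.exp (-p) - Real.exp (-q)| ≤ |p - q| * (Real.exp (-p) + Real.exp (-q)) := by
  have key : ∀ p q : ℝ, p ≤ q →
      |Real.exp (-p) - Real.exp (-q)| ≤ |p - q| * (Real.exp (-p) + Real.exp (-q)) := by
    intro p q hpq
    have h1 : Real.exp (-q) = Real.exp (-p) * Real.exp (-(q - p)) := by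
      rw [← Real.exp_add]
      ring_nf
    have h2 := Real.one_sub_le_exp_neg (q - p)
    have h3 := Real.exp_pos (-p)
    have h4 := Real.exp_pos (-q)
    rw [abs_of_nonneg (sub_nonneg.2 (Real.exp_le_exp.2 (by linarith))), abs_sub_comm,
      abs_of_nonneg (sub_nonneg.2 hpq)]
    nlinarith [mul_nonneg (sub_nonneg.2 hpq) h4.le]
  rcases le_total p q with h | h
  · exact key p q h
  · rw [abs_sub_comm, abs_sub_comm p, add_comm]
    exact key q p h

theorem poly_mul_gaussian_le {x y : ℝ} (hx : 0 ≤ x) (hy : 0 ≤ y) (hxy : |x - y| ≤ 1) :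
    (x + y) * (1 + y ^ 2) * (Real.exp (-x ^ 2) + Real.exp (-y ^ 2)) ≤
      128 * Real.exp 1 * Real.exp (-(x ^ 2 / 4)) := by
  obtain ⟨h1, h2⟩ := abs_le.1 hxy
  have h3 : Real.exp (-x ^ 2) ≤ Real.exp 1 * Real.exp (-(x ^ 2 / 4)) * Real.exp (-(x ^ 2 / 4)) := by
    rw [← Real.exp_add, ← Real.exp_add]
    refine Real.exp_le_exp.2 ?_
    nlinarith
  have h4 : Real.exp (-y ^ 2) ≤ Real.exp 1 * Real.exp (-(x ^ 2 / 4)) * Real.exp (-(x ^ 2 / 4)) := by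
    rw [← Real.exp_add, ← Real.exp_add]
    refine Real.exp_le_exp.2 ?_
    nlinarith [sq_nonneg (y - 1)]
  have h5 : 1 + x ^ 2 / 4 + (x ^ 2 / 4) ^ 2 / 2 ≤ Real.exp (x ^ 2 / 4) :=
    Real.quadratic_le_exp_of_nonneg (by positivity)
  have h6 : (x + y) * (1 + y ^ 2) ≤ 64 * Real.exp (x ^ 2 / 4) := by
    have : (x + y) * (1 + y ^ 2) ≤ (2 * x + 1) * (1 + (x + 1) ^ 2) := by
      have h8 : y ^ 2 ≤ (x + 1) ^ 2 := pow_le_pow_left₀ hy (by linarith) 2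
      exact mul_le_mul (by linarith) (by linarith) (by positivity) (by positivity)
    nlinarith [mul_nonneg hx (sq_nonneg (x - 1)), sq_nonneg (x - 1), sq_nonneg (x ^ 2 - x)]
  have h7 : Real.exp (x ^ 2 / 4) * Real.exp (-(x ^ 2 / 4)) = 1 := by
    rw [← Real.exp_add]
    simp
  calc _ ≤ 64 * Real.exp (x ^ 2 / 4) *
        (2 * (Real.exp 1 * Real.exp (-(x ^ 2 / 4)) * Real.exp (-(x ^ 2 / 4)))) := by
        gcongr
        linarith
    _ = 128 * Real.exp 1 * Real.exp (-(x ^ 2 / 4)) *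
        (Real.exp (x ^ 2 / 4) * Real.exp (-(x ^ 2 / 4))) := by ring
    _ = _ := by rw [h7, mul_one]

/-- A smoothing estimate for the kernel `kerZ s` at distances below its scale. -/
theorem norm_kerZ_sub_le {s : ℝ} (hs : 0 < s) {a b : ℂ} (hab : s * ‖a - b‖ ^ 2 ≤ 1) :
    ‖kerZ s a - kerZ s b‖ ≤
      128 * Real.exp 1 * (√s * ‖a - b‖) * Real.exp (-(s / 4 * ‖a‖ ^ 2)) := by
  have hr := Real.sq_sqrt hs.le
  have hr0 := Real.sqrt_nonneg s
  set r := √s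
  set x := r * ‖a‖ with hx
  set y := r * ‖b‖ with hy
  set d := r * ‖a - b‖ with hd
  have hx0 : 0 ≤ x := by positivity
  have hy0 : 0 ≤ y := by positivity
  have hd0 : 0 ≤ d := by positivity
  have hx2 : s * ‖a‖ ^ 2 = x ^ 2 := by rw [hx, mul_pow, hr]
  have hy2 : s * ‖b‖ ^ 2 = y ^ 2 := by rw [hy, mul_pow, hr]
  have hd1 : d ≤ 1 := by
    have : d ^ 2 ≤ 1 := by rwa [hd, mul_pow, hr]
    nlinarith
  have hxy : |x - y| ≤ d := by
    rw [hx, hy, hd, ← mul_sub, abs_mul, abs_of_nonneg hr0]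
    exact mul_le_mul_of_nonneg_left (abs_norm_sub_norm_le a b) hr0
  have hsq : |x ^ 2 - y ^ 2| ≤ d * (x + y) := by
    rw [sq_sub_sq, abs_mul, abs_of_nonneg (add_nonneg hx0 hy0), mul_comm]
    exact mul_le_mul_of_nonneg_right hxy (add_nonneg hx0 hy0)
  have hE := abs_exp_neg_sub_exp_neg_le (x ^ 2) (y ^ 2)
  have hsplit : kerZ s a - kerZ s b =
      ((Real.exp (-x ^ 2) : ℝ) : ℂ) * ((r : ℂ) * (starRingEnd ℂ) (a - b)) *
        ((r : ℂ) * (starRingEnd ℂ) (a + b)) +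
      ((Real.exp (-x ^ 2) - Real.exp (-y ^ 2) : ℝ) : ℂ) * ((r : ℂ) * (starRingEnd ℂ) b) ^ 2 := by
    rw [kerZ, kerZ, hx2, hy2, ← hr]
    push_cast
    simp only [map_sub, map_add]
    ring
  have hn1 : ‖(r : ℂ) * (starRingEnd ℂ) (a - b)‖ = d := by
    rw [norm_mul, RCLike.norm_conj, Complex.norm_real, Real.norm_of_nonneg hr0]
  have hn2 : ‖(r : ℂ) * (starRingEnd ℂ) (a + b)‖ ≤ x + y := by
    rw [norm_mul, RCLike.norm_conj, Complex.norm_real, Real.norm_of_nonneg hr0, hx, hy, ← mul_add]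
    exact mul_le_mul_of_nonneg_left (norm_add_le a b) hr0
  have hn3 : ‖(r : ℂ) * (starRingEnd ℂ) b‖ = y := by
    rw [norm_mul, RCLike.norm_conj, Complex.norm_real, Real.norm_of_nonneg hr0]
  have hpoly := poly_mul_gaussian_le hx0 hy0 (hxy.trans hd1)
  have hex := Real.exp_pos (-x ^ 2)
  have hey := Real.exp_pos (-y ^ 2)
  rw [show s / 4 * ‖a‖ ^ 2 = x ^ 2 / 4 by rw [← hx2]; ring, hsplit]
  refine (norm_add_le _ _).trans ?_
  rw [norm_mul _ ((r : ℂ) * (starRingEnd ℂ) (a + b)), norm_mul _ ((r : ℂ) * (starRingEnd ℂ) (a - b)),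
    norm_mul _ (_ ^ 2), norm_pow, hn1, hn3, Complex.norm_real, Complex.norm_real,
    Real.norm_of_nonneg hex.le, Real.norm_eq_abs]
  calc _ ≤ Real.exp (-x ^ 2) * d * (x + y) +
        d * (x + y) * (Real.exp (-x ^ 2) + Real.exp (-y ^ 2)) * y ^ 2 := by
        gcongr
        exact hE.trans (mul_le_mul_of_nonneg_right hsq (by positivity))
    _ ≤ d * ((x + y) * (1 + y ^ 2) * (Real.exp (-x ^ 2) + Real.exp (-y ^ 2))) := by
        have : 0 ≤ d * (x + y) * Real.exp (-y ^ 2) := by positivity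
        linarith
    _ ≤ d * (128 * Real.exp 1 * Real.exp (-(x ^ 2 / 4))) := mul_le_mul_of_nonneg_left hpoly hd0
    _ = _ := by ring

/-! ### Estimates for Hölder functions supported in a disk -/

theorem continuous_of_holder {f : ℂ → ℂ} {α M : ℝ} (hα : 0 < α)
    (hf : ∀ z w, ‖f z - f w‖ ≤ M * ‖z - w‖ ^ α) : Continuous f := by
  rw [continuous_iff_continuousAt]
  intro z
  rw [ContinuousAt, tendsto_iff_norm_sub_tendsto_zero]
  have h1 : Continuous fun w : ℂ => M * ‖w - z‖ ^ α :=
    continuous_const.mul (Continuous.rpow_const (by fun_prop) fun _ => Or.inr hα.le)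
  refine squeeze_zero (fun _ => norm_nonneg _) (fun w => hf w z) ?_
  simpa [Real.zero_rpow hα.ne'] using h1.tendsto z

/-- `h` is `α`-Hölder with constant `M` and vanishes outside the open disk of radius `R`. -/
structure HolderSupported (α R M : ℝ) (h : ℂ → ℂ) : Prop where
  holder : ∀ z w, ‖h z - h w‖ ≤ M * ‖z - w‖ ^ α
  eq_zero : ∀ z, R ≤ ‖z‖ → h z = 0

namespace HolderSupported

variable {α R M : ℝ} {h : ℂ → ℂ}

theorem nonneg (H : HolderSupported α R M h) : 0 ≤ M := by
  simpa using (norm_nonneg _).trans (H.holder 1 0)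

theorem continuous (H : HolderSupported α R M h) (hα : 0 < α) : Continuous h :=
  continuous_of_holder hα H.holder

theorem hasCompactSupport (H : HolderSupported α R M h) : HasCompactSupport h := by
  refine HasCompactSupport.intro (isCompact_closedBall 0 R) fun z hz => H.eq_zero z ?_
  rw [Metric.mem_closedBall, dist_zero_right, not_le] at hz
  exact hz.le

end HolderSupported

/-- The decay constant of Gaussian averages of an `α`-Hölder function. -/
noncomputable def decayConst (α : ℝ) : ℝ :=
  2 * (Real.pi * Real.Gamma (1 + α / 2) * 2 ^ (1 + α / 2))

/-- The Lipschitz constant of Gaussian averages of an `α`-Hölder function. -/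
noncomputable def smoothConst (α : ℝ) : ℝ :=
  128 * Real.exp 1 * (Real.pi * Real.Gamma (1 + α / 2) * 4 ^ (1 + α / 2))

theorem decayConst_pos {α : ℝ} (hα : 0 < α) : 0 < decayConst α := by
  have : 0 < Real.Gamma (1 + α / 2) := Real.Gamma_pos_of_pos (by linarith)
  unfold decayConst
  positivity

theorem smoothConst_pos {α : ℝ} (hα : 0 < α) : 0 < smoothConst α := by
  have : 0 < Real.Gamma (1 + α / 2) := Real.Gamma_pos_of_pos (by linarith)
  unfold smoothConst
  positivity

theorem div_rpow_neg_eq {s c p : ℝ} (hs : 0 < s) (hc : 0 < c) :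
    (s / c) ^ (-p) = c ^ p * s ^ (-p) := by
  rw [Real.div_rpow hs.le hc.le, Real.rpow_neg hc.le, div_inv_eq_mul, mul_comm]

namespace HolderSupported

variable {α R M : ℝ} {h : ℂ → ℂ}

theorem norm_kernelConv_le_of_integral_eq_zero (H : HolderSupported α R M h) (hα : 0 < α) {s : ℝ}
    (hs : 0 < s) {K : ℂ → ℂ} (hK : Continuous K) (hK0 : ∫ u, K u = 0)
    (hle : ∀ u, ‖K u‖ ≤ 2 * Real.exp (-(s / 2 * ‖u‖ ^ 2))) (z : ℂ) :
    ‖kernelConv h K z‖ ≤ M * decayConst α * s ^ (-(1 + α / 2)) := by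
  have h1 := norm_kernelConv_sub_le hα H.holder (H.continuous hα) H.hasCompactSupport hK
    (half_pos hs) hle z
  rw [hK0, mul_zero, sub_zero, div_rpow_neg_eq hs two_pos] at h1
  refine h1.trans_eq ?_
  rw [decayConst]
  ring

theorem norm_kernelConv_kerZ_le (H : HolderSupported α R M h) (hα : 0 < α) {s : ℝ} (hs : 0 < s)
    (z : ℂ) : ‖kernelConv h (kerZ s) z‖ ≤ M * decayConst α * s ^ (-(1 + α / 2)) :=
  H.norm_kernelConv_le_of_integral_eq_zero hα hs (continuous_kerZ.comp (Continuous.prodMk_right s))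
    (integral_kerZ s) (norm_kerZ_le hs.le) z

theorem norm_kernelConv_kerZbar_le (H : HolderSupported α R M h) (hα : 0 < α) {s : ℝ} (hs : 0 < s)
    (z : ℂ) : ‖kernelConv h (kerZbar s) z‖ ≤ M * decayConst α * s ^ (-(1 + α / 2)) :=
  H.norm_kernelConv_le_of_integral_eq_zero hα hs
    (continuous_kerZbar.comp (Continuous.prodMk_right s))
    (integral_kerZbar hs) (norm_kerZbar_le hs.le) z

theorem norm_kernelConv_kerZ_sub_le (H : HolderSupported α R M h) (hα : 0 < α) {s : ℝ}
    (hs : 0 < s) {z₁ z₂ : ℂ} (hz : s * ‖z₁ - z₂‖ ^ 2 ≤ 1) :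
    ‖kernelConv h (kerZ s) z₁ - kernelConv h (kerZ s) z₂‖ ≤
      M * smoothConst α * ‖z₁ - z₂‖ * s ^ (-(1 / 2 + α / 2)) := by
  have hK : Continuous (kerZ s) := continuous_kerZ.comp (Continuous.prodMk_right s)
  have hc := H.continuous hα
  have hi : Integrable (kerZ s) :=
    ((integrable_gaussian_plane (half_pos hs)).const_mul 2).mono' hK.aestronglyMeasurable
      (Eventually.of_forall (norm_kerZ_le hs.le))
  have h1 : kernelConv h (kerZ s) z₁ - kernelConv h (kerZ s) z₂ =
      kernelConv h (fun u => kerZ s u - kerZ s (u + (z₂ - z₁))) z₁ := by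
    rw [kernelConv, kernelConv, ← integral_sub
      (integrable_mul_kernel hc H.hasCompactSupport hK z₁)
      (integrable_mul_kernel hc H.hasCompactSupport hK z₂), kernelConv]
    refine integral_congr_ae (Eventually.of_forall fun w => ?_)
    simp only
    rw [show z₁ - w + (z₂ - z₁) = z₂ - w by ring, mul_sub]
  have h2 : ∫ u, (kerZ s u - kerZ s (u + (z₂ - z₁))) = 0 := by
    rw [integral_sub hi (hi.comp_add_right _), integral_add_right_eq_self (kerZ s), sub_self]
  have h3 := norm_kernelConv_sub_le hα H.holder hc H.hasCompactSupport
    (K := fun u => kerZ s u - kerZ s (u + (z₂ - z₁))) (by fun_prop) (show 0 < s / 4 by linarith)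
    (C := 128 * Real.exp 1 * (√s * ‖z₁ - z₂‖)) (fun u => by
      have h4 : u - (u + (z₂ - z₁)) = z₁ - z₂ := by ring
      have h5 := norm_kerZ_sub_le hs (a := u) (b := u + (z₂ - z₁)) (by rwa [h4])
      rwa [h4] at h5) z₁
  rw [h2, mul_zero, sub_zero, div_rpow_neg_eq hs four_pos] at h3
  rw [h1]
  refine h3.trans_eq ?_
  have h6 : s ^ (-(1 / 2 + α / 2)) = √s * s ^ (-(1 + α / 2)) := by
    rw [Real.sqrt_eq_rpow, ← Real.rpow_add hs]
    ring_nf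
  rw [h6, smoothConst]
  ring

end HolderSupported

theorem integrableOn_min_const_rpow {B C p : ℝ} (hB : 0 ≤ B) (hC : 0 ≤ C) (hp : 1 < p) :
    IntegrableOn (fun s : ℝ => min B (C * s ^ (-p))) (Ioi 0) := by
  have hm : Measurable fun s : ℝ => min B (C * s ^ (-p)) := by fun_prop
  have hnn : ∀ s : ℝ, 0 < s → 0 ≤ min B (C * s ^ (-p)) := fun s hs => by positivity
  rw [← Ioc_union_Ioi_eq_Ioi (zero_le_one' ℝ)]
  refine IntegrableOn.union ?_ ?_
  · refine Measure.integrableOn_of_bounded (M := B) (by simp) hm.aestronglyMeasurable ?_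
    refine (ae_restrict_iff' measurableSet_Ioc).2 (Eventually.of_forall fun s hs => ?_)
    rw [Real.norm_of_nonneg (hnn s hs.1)]
    exact min_le_left _ _
  · refine Integrable.mono' ((integrableOn_Ioi_rpow_of_lt (by linarith : -p < -1)
      one_pos).const_mul C) hm.aestronglyMeasurable ?_
    refine (ae_restrict_iff' measurableSet_Ioi).2 (Eventually.of_forall fun s hs => ?_)
    rw [Real.norm_of_nonneg (hnn s (one_pos.trans hs))]
    exact min_le_right _ _

theorem integrableOn_Ioi_of_norm_le_min {E : Type*} [NormedAddCommGroup E] {q : ℝ → E}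
    {B C p : ℝ} (hB : 0 ≤ B) (hC : 0 ≤ C) (hp : 1 < p) (hq : ContinuousOn q (Ioi 0))
    (h1 : ∀ s, 0 < s → ‖q s‖ ≤ B) (h2 : ∀ s, 0 < s → ‖q s‖ ≤ C * s ^ (-p)) :
    IntegrableOn q (Ioi 0) :=
  (integrableOn_min_const_rpow hB hC hp).mono' (hq.aestronglyMeasurable measurableSet_Ioi)
    ((ae_restrict_iff' measurableSet_Ioi).2
      (Eventually.of_forall fun s hs => le_min (h1 s hs) (h2 s hs)))

/-- Interpolation between a decay bound and a smoothness bound over all scales. -/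
theorem norm_integral_Ioi_le_rpow {q : ℝ → ℂ} {α A B δ : ℝ} (hα0 : 0 < α) (hα1 : α < 1)
    (hδ : 0 < δ) (hq : IntegrableOn q (Ioi 0))
    (h1 : ∀ s, 0 < s → s * δ ^ 2 ≤ 1 → ‖q s‖ ≤ A * δ * s ^ (-(1 / 2 + α / 2)))
    (h2 : ∀ s, 0 < s → ‖q s‖ ≤ B * s ^ (-(1 + α / 2))) :
    ‖∫ s in Ioi 0, q s‖ ≤ (A / (1 / 2 - α / 2) + B / (α / 2)) * δ ^ α := by
  set c : ℝ := (δ ^ 2)⁻¹ with hc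
  have hc0 : 0 < c := by positivity
  have hcpow : ∀ t : ℝ, c ^ t = δ ^ (-(2 * t)) := fun t => by
    rw [hc, ← Real.rpow_two, ← Real.rpow_neg hδ.le, ← Real.rpow_mul hδ.le]
    ring_nf
  rw [← Ioc_union_Ioi_eq_Ioi hc0.le, setIntegral_union (Ioc_disjoint_Ioi le_rfl) measurableSet_Ioi
    (hq.mono_set Ioc_subset_Ioi_self) (hq.mono_set (Ioi_subset_Ioi hc0.le))]
  refine (norm_add_le _ _).trans ?_
  rw [add_mul]
  refine add_le_add ?_ ?_
  · have hi : IntegrableOn (fun s : ℝ => s ^ (-(1 / 2 + α / 2))) (Ioc 0 c) :=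
      (intervalIntegrable_iff_integrableOn_Ioc_of_le hc0.le).1
        (intervalIntegral.intervalIntegrable_rpow' (by linarith))
    refine (norm_integral_le_of_norm_le (hi.const_mul (A * δ))
      ((ae_restrict_iff' measurableSet_Ioc).2 (Eventually.of_forall fun s hs => ?_))).trans_eq ?_
    · refine h1 s hs.1 ?_
      have : s * δ ^ 2 ≤ c * δ ^ 2 := mul_le_mul_of_nonneg_right hs.2 (by positivity)
      rwa [hc, inv_mul_cancel₀ (by positivity)] at this
    · rw [integral_const_mul, ← intervalIntegral.integral_of_le hc0.le,
        integral_rpow (Or.inl (by linarith)), Real.zero_rpow (by linarith), sub_zero, hcpow,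
        show -(1 / 2 + α / 2) + 1 = 1 / 2 - α / 2 by ring,
        show -(2 * (1 / 2 - α / 2)) = α - 1 by ring, Real.rpow_sub_one hδ.ne']
      field_simp
  · have hi := integrableOn_Ioi_rpow_of_lt (by linarith : -(1 + α / 2) < -1) hc0
    refine (norm_integral_le_of_norm_le (hi.const_mul B)
      ((ae_restrict_iff' measurableSet_Ioi).2 (Eventually.of_forall fun s hs =>
        h2 s (hc0.trans hs)))).trans_eq ?_
    rw [integral_const_mul, integral_Ioi_rpow_of_lt (by linarith) hc0, hcpow,
      show -(1 + α / 2) + 1 = -(α / 2) by ring, show -(2 * -(α / 2)) = α by ring, neg_div_neg_eq]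
    ring

namespace HolderSupported

variable {α R M : ℝ} {h : ℂ → ℂ}

theorem integrableOn_kernelConv_kerZ (H : HolderSupported α R M h) (hα : 0 < α) (z : ℂ) :
    IntegrableOn (fun s => kernelConv h (kerZ s) z) (Ioi 0) := by
  have hc := H.continuous hα
  have hd := decayConst_pos hα
  have hM := H.nonneg
  refine integrableOn_Ioi_of_norm_le_min (B := (∫ w, ‖h w‖) * 2) (by positivity) (by positivity)
    (by linarith) ?_ (fun s hs => norm_kernelConv_le hc H.hasCompactSupport (fun u => ?_) z)
    fun s hs => H.norm_kernelConv_kerZ_le hα hs z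
  · exact ((continuous_kernelConv_uncurry hc H.hasCompactSupport continuous_kerZ).comp
      (Continuous.prodMk_left z)).continuousOn
  · refine (norm_kerZ_le hs.le u).trans (mul_le_of_le_one_right two_pos.le ?_)
    exact Real.exp_le_one_iff.2 (neg_nonpos.2 (by positivity))

theorem integrableOn_kernelConv_kerZbar (H : HolderSupported α R M h) (hα : 0 < α) (z : ℂ) :
    IntegrableOn (fun s => kernelConv h (kerZbar s) z) (Ioi 0) := by
  have hc := H.continuous hα
  have hd := decayConst_pos hα
  have hM := H.nonneg
  refine integrableOn_Ioi_of_norm_le_min (B := (∫ w, ‖h w‖) * 2) (by positivity) (by positivity)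
    (by linarith) ?_ (fun s hs => norm_kernelConv_le hc H.hasCompactSupport (fun u => ?_) z)
    fun s hs => H.norm_kernelConv_kerZbar_le hα hs z
  · exact ((continuous_kernelConv_uncurry hc H.hasCompactSupport continuous_kerZbar).comp
      (Continuous.prodMk_left z)).continuousOn
  · refine (norm_kerZbar_le hs.le u).trans (mul_le_of_le_one_right two_pos.le ?_)
    exact Real.exp_le_one_iff.2 (neg_nonpos.2 (by positivity))

end HolderSupported

/-- The Gaussian kernel `s exp(-s|u|²)`, a primitive of `kerZbar` in the parameter `s`. -/
noncomputable def kerG (s : ℝ) (u : ℂ) : ℂ := ((s * Real.exp (-(s * ‖u‖ ^ 2)) : ℝ) : ℂ)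

theorem continuous_kerG : Continuous fun p : ℝ × ℂ => kerG p.1 p.2 := by
  unfold kerG
  fun_prop

theorem integral_kerG {s : ℝ} (hs : 0 < s) : ∫ u, kerG s u = Real.pi := by
  unfold kerG
  rw [integral_complex_ofReal, integral_const_mul, integral_gaussian_plane hs,
    mul_div_cancel₀ _ hs.ne']

theorem hasDerivAt_kerG (s : ℝ) (u : ℂ) : HasDerivAt (fun t => kerG t u) (kerZbar s u) s := by
  have h1 : HasDerivAt (fun t : ℝ => t * Real.exp (-(t * ‖u‖ ^ 2)))
      (1 * Real.exp (-(s * ‖u‖ ^ 2)) + s * (Real.exp (-(s * ‖u‖ ^ 2)) * -(1 * ‖u‖ ^ 2))) s :=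
    (hasDerivAt_id s).mul (((hasDerivAt_id s).mul_const _).neg.exp)
  refine h1.ofReal_comp.congr_deriv ?_
  rw [kerZbar]
  push_cast
  ring

theorem hasDerivAt_kernelConv_kerG {h : ℂ → ℂ} (hc : Continuous h) (hs : HasCompactSupport h)
    (s : ℝ) (z : ℂ) :
    HasDerivAt (fun t => kernelConv h (kerG t) z) (kernelConv h (kerZbar s) z) s := by
  have hcb : Continuous fun p : ℝ × ℂ => kerZbar p.1 (z - p.2) :=
    continuous_kerZbar.comp (f := fun p : ℝ × ℂ => (p.1, z - p.2)) (by fun_prop)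
  have hcs : Continuous fun p : ℝ × ℂ =>
      ContinuousLinearMap.toSpanSingleton ℝ (kerZbar p.1 (z - p.2)) :=
    (ContinuousLinearMap.toSpanSingletonCLE (𝕜 := ℝ) (E := ℂ)).continuous.comp hcb
  have hd := hasFDerivAt_integral_mul_of_hasCompactSupport hc hs
    (φ := fun t w => kerG t (z - w))
    (φ' := fun t w => ContinuousLinearMap.toSpanSingleton ℝ (kerZbar t (z - w)))
    (continuous_kerG.comp (f := fun p : ℝ × ℂ => (p.1, z - p.2)) (by fun_prop)) hcs
    (fun t w => (hasDerivAt_kerG t (z - w)).hasFDerivAt) s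
  have hd' := hd.hasDerivAt
  rw [ContinuousLinearMap.integral_apply] at hd'
  · simpa [kernelConv] using hd'
  · have hcs' : Continuous fun w => ContinuousLinearMap.toSpanSingleton ℝ (kerZbar s (z - w)) :=
      hcs.comp (Continuous.prodMk_right s)
    have hcs'' : Continuous fun w =>
        h w • ContinuousLinearMap.toSpanSingleton ℝ (kerZbar s (z - w)) := hc.smul hcs'
    refine hcs''.integrable_of_hasCompactSupport (hs.mono fun w hw => ?_)
    contrapose! hw
    rw [Function.notMem_support] at hw ⊢
    rw [hw]
    exact zero_smul ℂ (ContinuousLinearMap.toSpanSingleton ℝ (kerZbar s (z - w)))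

namespace HolderSupported

variable {α R M : ℝ} {h : ℂ → ℂ}

theorem tendsto_kernelConv_kerG (H : HolderSupported α R M h) (hα : 0 < α) (z : ℂ) :
    Tendsto (fun s => kernelConv h (kerG s) z) atTop (nhds (Real.pi * h z)) := by
  have h1 : ∀ s : ℝ, 0 < s → ‖kernelConv h (kerG s) z - Real.pi * h z‖ ≤
      M * (Real.pi * Real.Gamma (1 + α / 2)) * s ^ (-(α / 2)) := fun s hs => by
    have h2 := norm_kernelConv_sub_le hα H.holder (H.continuous hα) H.hasCompactSupport
      (continuous_kerG.comp (Continuous.prodMk_right s)) hs (C := s) (fun u => by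
        change ‖kerG s u‖ ≤ _
        rw [kerG, Complex.norm_real, Real.norm_of_nonneg (by positivity)]) z
    change ‖kernelConv h (kerG s) z - h z * ∫ u, kerG s u‖ ≤ _ at h2
    rw [integral_kerG hs, mul_comm (h z)] at h2
    refine h2.trans_eq ?_
    rw [show -(1 + α / 2) = -(α / 2) - 1 by ring, Real.rpow_sub_one hs.ne']
    field_simp
  rw [tendsto_iff_norm_sub_tendsto_zero]
  refine squeeze_zero' (Eventually.of_forall fun _ => norm_nonneg _)
    ((eventually_gt_atTop 0).mono h1) ?_
  simpa using (tendsto_rpow_neg_atTop (half_pos hα)).const_mul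
    (M * (Real.pi * Real.Gamma (1 + α / 2)))

theorem integral_kernelConv_kerZbar (H : HolderSupported α R M h) (hα : 0 < α) (z : ℂ) :
    ∫ s in Ioi 0, kernelConv h (kerZbar s) z = Real.pi * h z := by
  rw [integral_Ioi_of_hasDerivAt_of_tendsto'
    (fun s _ => hasDerivAt_kernelConv_kerG (H.continuous hα) H.hasCompactSupport s z)
    (H.integrableOn_kernelConv_kerZbar hα z) (H.tendsto_kernelConv_kerG hα z)]
  simp [kernelConv, kerG]

end HolderSupported

theorem integrableOn_kernelConv_kerP {h : ℂ → ℂ} (hc : Continuous h) (hs : HasCompactSupport h)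
    (z : ℂ) : IntegrableOn (fun s => kernelConv h (kerP s) z) (Ioi 0) := by
  obtain ⟨B, hB⟩ := hc.bounded_above_of_compact_support hs
  have hB0 : 0 ≤ B := (norm_nonneg _).trans (hB 0)
  have hG : 0 < Real.Gamma (1 + 1 / 2) := Real.Gamma_pos_of_pos (by norm_num)
  have hP : ∀ (s : ℝ) (u : ℂ), ‖kerP s u‖ = ‖u‖ * Real.exp (-(s * ‖u‖ ^ 2)) := fun s u => by
    rw [kerP, norm_mul, Complex.norm_real, RCLike.norm_conj, Real.norm_of_nonneg (by positivity),
      mul_comm]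
  refine integrableOn_Ioi_of_norm_le_min (B := ∫ w, ‖h w‖ * ‖z - w‖)
    (C := B * (Real.pi * Real.Gamma (1 + 1 / 2))) (p := 1 + 1 / 2)
    (by positivity) (by positivity) (by norm_num) ?_ (fun s hs' => ?_) fun s hs' => ?_
  · exact ((continuous_kernelConv_uncurry hc hs continuous_kerP).comp
      (Continuous.prodMk_left z)).continuousOn
  · refine norm_integral_le_of_norm_le (Continuous.integrable_of_hasCompactSupport (by fun_prop)
      hs.norm.mul_right) (Eventually.of_forall fun w => ?_)
    rw [norm_mul, hP]
    refine mul_le_mul_of_nonneg_left (mul_le_of_le_one_right (norm_nonneg _) ?_) (norm_nonneg _)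
    exact Real.exp_le_one_iff.2 (neg_nonpos.2 (by positivity))
  · have hi := integrable_norm_rpow_mul_gaussian (q := 1) (by norm_num) hs'
    have he := integral_norm_rpow_mul_gaussian (q := 1) (by norm_num) hs'
    rw [mul_assoc, ← he, ← integral_const_mul, ← integral_sub_left_eq_self _ _ z]
    refine norm_integral_le_of_norm_le ((hi.const_mul B).comp_sub_left z)
      (Eventually.of_forall fun w => ?_)
    rw [norm_mul, hP, Real.rpow_one]
    exact mul_le_mul_of_nonneg_right (hB w) (by positivity)

/-- The normalised Beurling transform `(S h)(z) - (S h)(0)`, where `S` is realised as a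
superposition of Gaussian-type averages. -/
noncomputable def beurling (h : ℂ → ℂ) (z : ℂ) : ℂ :=
  -(Real.pi : ℂ)⁻¹ * ∫ s in Ioi 0, (kernelConv h (kerZ s) z - kernelConv h (kerZ s) 0)

/-- The Cauchy transform `π⁻¹ ∫ h(w) / (z - w) dw`, realised as a superposition of
Gaussian-type averages. -/
noncomputable def cauchyTransform (h : ℂ → ℂ) (z : ℂ) : ℂ :=
  (Real.pi : ℂ)⁻¹ * ∫ s in Ioi 0, kernelConv h (kerP s) z

/-- The norm bound of the Beurling transform on `α`-Hölder functions. -/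
noncomputable def beurlingConst (α : ℝ) : ℝ :=
  Real.pi⁻¹ * (smoothConst α / (1 / 2 - α / 2) + 2 * decayConst α / (α / 2))

theorem beurlingConst_pos {α : ℝ} (hα0 : 0 < α) (hα1 : α < 1) : 0 < beurlingConst α := by
  have h1 := smoothConst_pos hα0
  have h2 := decayConst_pos hα0
  have h3 : 0 < 1 / 2 - α / 2 := by linarith
  unfold beurlingConst
  positivity

theorem beurling_zero (h : ℂ → ℂ) : beurling h 0 = 0 := by
  simp [beurling]

theorem beurling_eq {α R M : ℝ} {h : ℂ → ℂ} (H : HolderSupported α R M h) (hα : 0 < α) (z : ℂ) :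
    beurling h z = -(Real.pi : ℂ)⁻¹ * (∫ s in Ioi 0, kernelConv h (kerZ s) z) -
      -(Real.pi : ℂ)⁻¹ * ∫ s in Ioi 0, kernelConv h (kerZ s) 0 := by
  rw [beurling, integral_sub (H.integrableOn_kernelConv_kerZ hα z)
    (H.integrableOn_kernelConv_kerZ hα 0)]
  ring

namespace HolderSupported

variable {α R M : ℝ} {h : ℂ → ℂ}

theorem norm_beurling_sub_le (H : HolderSupported α R M h) (hα0 : 0 < α) (hα1 : α < 1)
    (z₁ z₂ : ℂ) :
    ‖beurling h z₁ - beurling h z₂‖ ≤ beurlingConst α * M * ‖z₁ - z₂‖ ^ α := by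
  rcases eq_or_ne z₁ z₂ with rfl | hz
  · simp [Real.zero_rpow hα0.ne']
  have hδ : 0 < ‖z₁ - z₂‖ := norm_pos_iff.2 (sub_ne_zero.2 hz)
  have hi1 := H.integrableOn_kernelConv_kerZ hα0 z₁
  have hi2 := H.integrableOn_kernelConv_kerZ hα0 z₂
  have h1 : beurling h z₁ - beurling h z₂ = -(Real.pi : ℂ)⁻¹ *
      ∫ s in Ioi 0, (kernelConv h (kerZ s) z₁ - kernelConv h (kerZ s) z₂) := by
    rw [beurling_eq H hα0, beurling_eq H hα0, integral_sub hi1 hi2]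
    ring
  have h2 := norm_integral_Ioi_le_rpow (A := M * smoothConst α) (B := 2 * (M * decayConst α))
    hα0 hα1 hδ (hi1.sub hi2)
    (fun s hs hsδ => H.norm_kernelConv_kerZ_sub_le hα0 hs hsδ) (fun s hs => by
      refine (norm_sub_le _ _).trans ?_
      linarith [H.norm_kernelConv_kerZ_le hα0 hs z₁, H.norm_kernelConv_kerZ_le hα0 hs z₂])
  rw [h1, norm_mul, norm_neg, norm_inv, Complex.norm_real, Real.norm_of_nonneg Real.pi_pos.le]
  refine (mul_le_mul_of_nonneg_left h2 (by positivity)).trans_eq ?_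
  rw [beurlingConst]
  ring

theorem norm_beurling_le (H : HolderSupported α R M h) (hα0 : 0 < α) (hα1 : α < 1) {z : ℂ}
    (hz : ‖z‖ ≤ R) : ‖beurling h z‖ ≤ beurlingConst α * M * R ^ α := by
  have h1 := H.norm_beurling_sub_le hα0 hα1 z 0
  rw [beurling_zero, sub_zero, sub_zero] at h1
  have h2 := beurlingConst_pos hα0 hα1
  have h3 := H.nonneg
  exact h1.trans (by gcongr)

theorem hasFDerivAt_cauchyTransform (H : HolderSupported α R M h) (hα : 0 < α) (z : ℂ) :
    HasFDerivAt (cauchyTransform h)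
      (wirtingerCLM (-(Real.pi : ℂ)⁻¹ * ∫ s in Ioi 0, kernelConv h (kerZ s) z) (h z)) z := by
  have hc := H.continuous hα
  have hcs := H.hasCompactSupport
  have hM := H.nonneg
  have hd := decayConst_pos hα
  have hZ := H.integrableOn_kernelConv_kerZ hα z
  have hZb := H.integrableOn_kernelConv_kerZbar hα z
  have hcont : ∀ y, Continuous fun s => kernelConv h (kerP s) y := fun y =>
    (continuous_kernelConv_uncurry hc hcs continuous_kerP).comp (Continuous.prodMk_left y)
  have hexp : ∀ (s : ℝ) (u : ℂ), 0 < s → 2 * Real.exp (-(s / 2 * ‖u‖ ^ 2)) ≤ 2 := fun s u hs =>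
    mul_le_of_le_one_right two_pos.le (Real.exp_le_one_iff.2 (neg_nonpos.2 (by positivity)))
  have hsplit : ∀ s, wirtingerCLM (-kernelConv h (kerZ s) z) (kernelConv h (kerZbar s) z) =
      (-kernelConv h (kerZ s) z) • ContinuousLinearMap.id ℝ ℂ +
        kernelConv h (kerZbar s) z • (Complex.conjCLE : ℂ →L[ℝ] ℂ) := fun s => rfl
  have hZ' : IntegrableOn (fun s => -kernelConv h (kerZ s) z) (Ioi 0) := hZ.neg
  have h_integrable : IntegrableOn (fun s =>
      wirtingerCLM (-kernelConv h (kerZ s) z) (kernelConv h (kerZbar s) z)) (Ioi 0) :=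
    Integrable.add (f := fun s => (-kernelConv h (kerZ s) z) • ContinuousLinearMap.id ℝ ℂ)
      (Integrable.smul_const hZ' _) (Integrable.smul_const hZb (Complex.conjCLE : ℂ →L[ℝ] ℂ))
  have hbound := (integrableOn_min_const_rpow (B := (∫ w, ‖h w‖) * 2)
    (C := M * decayConst α) (p := 1 + α / 2) (by positivity) (by positivity)
    (by linarith)).const_mul 2
  have hF := hasFDerivAt_integral_of_dominated_of_fderiv_le (μ := volume.restrict (Ioi (0 : ℝ)))
    (F := fun y s => kernelConv h (kerP s) y)
    (F' := fun y s => wirtingerCLM (-kernelConv h (kerZ s) y) (kernelConv h (kerZbar s) y))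
    (x₀ := z) univ_mem (Eventually.of_forall fun y => (hcont y).aestronglyMeasurable)
    (integrableOn_kernelConv_kerP hc hcs z) h_integrable.aestronglyMeasurable
    ((ae_restrict_iff' measurableSet_Ioi).2 (Eventually.of_forall fun s hs y _ => by
      refine (norm_wirtingerCLM_le _ _).trans ?_
      rw [norm_neg, two_mul]
      exact add_le_add
        (le_min (norm_kernelConv_le hc hcs
          (fun u => (norm_kerZ_le (le_of_lt hs) u).trans (hexp s u hs)) y)
          (H.norm_kernelConv_kerZ_le hα hs y))
        (le_min (norm_kernelConv_le hc hcs
          (fun u => (norm_kerZbar_le (le_of_lt hs) u).trans (hexp s u hs)) y)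
          (H.norm_kernelConv_kerZbar_le hα hs y)))) hbound
    (Eventually.of_forall fun s y _ => hasFDerivAt_kernelConv_kerP hc hcs s y)
  have hF2 := hF.const_mul (Real.pi : ℂ)⁻¹
  refine hF2.congr_fderiv ?_
  simp_rw [hsplit]
  rw [integral_add (hZ'.smul_const _) (hZb.smul_const _), integral_smul_const,
    integral_smul_const, integral_neg, H.integral_kernelConv_kerZbar hα, wirtingerCLM, smul_add,
    smul_smul, smul_smul, inv_mul_cancel_left₀ (by exact_mod_cast Real.pi_ne_zero), mul_neg,
    neg_mul]

end HolderSupported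

/-! ### The fixed point -/

namespace HolderSupported

variable {α R M N : ℝ} {f g h : ℂ → ℂ}

theorem zero (hM : 0 ≤ M) : HolderSupported α R M 0 :=
  ⟨fun z w => by simpa using mul_nonneg hM (Real.rpow_nonneg (norm_nonneg _) _), fun _ _ => rfl⟩

theorem add (hf : HolderSupported α R M f) (hg : HolderSupported α R N g) :
    HolderSupported α R (M + N) (f + g) :=
  ⟨fun z w => by
    rw [Pi.add_apply, Pi.add_apply, add_sub_add_comm, add_mul]
    exact (norm_add_le _ _).trans (add_le_add (hf.holder z w) (hg.holder z w)),
  fun z hz => by simp [hf.eq_zero z hz, hg.eq_zero z hz]⟩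

theorem sub (hf : HolderSupported α R M f) (hg : HolderSupported α R N g) :
    HolderSupported α R (M + N) (f - g) :=
  ⟨fun z w => by
    rw [Pi.sub_apply, Pi.sub_apply, sub_sub_sub_comm, add_mul]
    exact (norm_sub_le _ _).trans (add_le_add (hf.holder z w) (hg.holder z w)),
  fun z hz => by simp [hf.eq_zero z hz, hg.eq_zero z hz]⟩

theorem norm_le (hf : HolderSupported α R M f) (z : ℂ) : ‖f z‖ ≤ M * ‖z - R‖ ^ α := by
  have h1 := hf.holder z R
  rwa [hf.eq_zero R (by simpa using le_abs_self R), sub_zero] at h1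

/-- The contraction principle for the Hölder seminorm on functions supported in a disk. -/
theorem exists_fixedPoint {Φ : (ℂ → ℂ) → ℂ → ℂ} (hN : 0 ≤ N)
    (hmaps : ∀ f, HolderSupported α R N f → HolderSupported α R N (Φ f))
    (hcontr : ∀ f g M, HolderSupported α R N f → HolderSupported α R N g →
      HolderSupported α R M (f - g) → HolderSupported α R (M / 2) (Φ f - Φ g)) :
    ∃ h, HolderSupported α R N h ∧ Φ h = h := by
  let u : ℕ → ℂ → ℂ := fun n => Φ^[n] 0
  have hu_succ : ∀ n, u (n + 1) = Φ (u n) := fun n => Function.iterate_succ_apply' Φ n 0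
  have hu : ∀ n, HolderSupported α R N (u n) := fun n => by
    induction n with
    | zero => exact zero hN
    | succ n ih => exact hu_succ n ▸ hmaps _ ih
  have hdiff : ∀ n, HolderSupported α R (2 * N * (1 / 2) ^ n) (u n - u (n + 1)) := fun n => by
    induction n with
    | zero => simpa [two_mul] using (hu 0).sub (hu 1)
    | succ n ih =>
      have h1 := hcontr _ _ _ (hu n) (hu (n + 1)) ih
      rw [← hu_succ, ← hu_succ] at h1
      convert h1 using 1
      ring
  have hlim : ∀ z, ∃ y, Tendsto (fun n => u n z) atTop (nhds y) := fun z => by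
    refine cauchySeq_tendsto_of_complete (cauchySeq_of_le_geometric (1 / 2)
      (2 * N * ‖z - R‖ ^ α) (by norm_num) fun n => ?_)
    rw [dist_eq_norm]
    refine ((hdiff n).norm_le z).trans_eq ?_
    ring
  choose h hh using hlim
  have hH : HolderSupported α R N h := by
    refine ⟨fun z w => ?_, fun z hz => ?_⟩
    · exact le_of_tendsto ((hh z).sub (hh w)).norm (Eventually.of_forall fun n => (hu n).holder z w)
    · refine tendsto_nhds_unique (hh z) ?_
      simp [(hu _).eq_zero z hz]
  have htail : ∀ n, HolderSupported α R (4 * N * (1 / 2) ^ n) (u n - h) := fun n => by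
    refine ⟨fun z w => ?_, fun z hz => by simp [(hu n).eq_zero z hz, hH.eq_zero z hz]⟩
    have h1 := dist_le_of_le_geometric_of_tendsto (1 / 2) (2 * N * ‖z - w‖ ^ α) (by norm_num)
      (fun n => by
        have h2 := (hdiff n).holder z w
        rw [Pi.sub_apply, Pi.sub_apply, sub_sub_sub_comm] at h2
        rw [dist_eq_norm]
        refine h2.trans_eq ?_
        ring) ((hh z).sub (hh w)) n
    rw [dist_eq_norm] at h1
    rw [Pi.sub_apply, Pi.sub_apply, sub_sub_sub_comm]
    refine h1.trans_eq ?_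
    ring
  refine ⟨h, hH, funext fun z => tendsto_nhds_unique ?_ ((tendsto_add_atTop_iff_nat 1).2 (hh z))⟩
  rw [tendsto_iff_norm_sub_tendsto_zero]
  refine squeeze_zero (fun _ => norm_nonneg _)
    (g := fun n : ℕ => 2 * N * ‖z - R‖ ^ α * (1 / 2) ^ n) (fun n => ?_) ?_
  · have h1 := (hcontr _ _ _ (hu n) hH (htail n)).norm_le z
    rw [Pi.sub_apply, ← hu_succ] at h1
    refine h1.trans_eq ?_
    ring
  · simpa using (tendsto_pow_atTop_nhds_zero_of_lt_one (r := (1 / 2 : ℝ)) (by norm_num)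
      (by norm_num)).const_mul (2 * N * ‖z - R‖ ^ α)

theorem beurling_sub (hf : HolderSupported α R M f) (hg : HolderSupported α R N g) (hα : 0 < α)
    (z : ℂ) : beurling (f - g) z = beurling f z - beurling g z := by
  have h1 : ∀ s y, kernelConv (f - g) (kerZ s) y =
      kernelConv f (kerZ s) y - kernelConv g (kerZ s) y := fun s y => by
    have hK : Continuous (kerZ s) := continuous_kerZ.comp (Continuous.prodMk_right s)
    rw [kernelConv, kernelConv, kernelConv, ← integral_sub
      (integrable_mul_kernel (hf.continuous hα) hf.hasCompactSupport hK y)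
      (integrable_mul_kernel (hg.continuous hα) hg.hasCompactSupport hK y)]
    simp only [Pi.sub_apply, sub_mul]
  rw [beurling_eq (hf.sub hg) hα, beurling_eq hf hα, beurling_eq hg hα]
  simp_rw [h1]
  rw [integral_sub (hf.integrableOn_kernelConv_kerZ hα z) (hg.integrableOn_kernelConv_kerZ hα z),
    integral_sub (hf.integrableOn_kernelConv_kerZ hα 0) (hg.integrableOn_kernelConv_kerZ hα 0)]
  ring

theorem norm_le_of_apply_zero (hf : HolderSupported α R M f) (hα : 0 < α) (hR : 0 ≤ R)
    (h0 : f 0 = 0) (z : ℂ) : ‖f z‖ ≤ M * R ^ α := by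
  have hM := hf.nonneg
  rcases le_or_gt R ‖z‖ with hz | hz
  · rw [hf.eq_zero z hz, norm_zero]
    positivity
  · have h1 := hf.holder z 0
    rw [h0, sub_zero, sub_zero] at h1
    exact h1.trans (by gcongr)

theorem mul_beurling {A : ℝ} {μ : ℂ → ℂ} (hμ : HolderSupported α R A μ) (hα0 : 0 < α)
    (hα1 : α < 1) (hR : 0 ≤ R) (hμ0 : μ 0 = 0) (hf : HolderSupported α R M f)
    (hsmall : A * R ^ α * beurlingConst α ≤ 1 / 4) :
    HolderSupported α R (M / 2) (μ * beurling f) := by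
  have hM := hf.nonneg
  have hA := hμ.nonneg
  have hC := beurlingConst_pos hα0 hα1
  have hnear : ∀ z w, ‖w‖ ≤ R →
      ‖μ z * beurling f z - μ w * beurling f w‖ ≤ M / 2 * ‖z - w‖ ^ α := fun z w hw => by
    have h1 : μ z * beurling f z - μ w * beurling f w =
      (μ z - μ w) * beurling f w + μ z * (beurling f z - beurling f w) := by ring
    rw [h1]
    refine (norm_add_le _ _).trans ?_
    rw [norm_mul, norm_mul]
    calc _ ≤ (A * ‖z - w‖ ^ α) * (beurlingConst α * M * R ^ α) +
          (A * R ^ α) * (beurlingConst α * M * ‖z - w‖ ^ α) := by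
          gcongr
          · exact hμ.holder z w
          · exact hf.norm_beurling_le hα0 hα1 hw
          · exact hμ.norm_le_of_apply_zero hα0 hR hμ0 z
          · exact hf.norm_beurling_sub_le hα0 hα1 z w
      _ = 2 * (A * R ^ α * beurlingConst α) * (M * ‖z - w‖ ^ α) := by ring
      _ ≤ 2 * (1 / 4) * (M * ‖z - w‖ ^ α) := by gcongr
      _ = _ := by ring
  refine ⟨fun z w => ?_, fun z hz => by simp [hμ.eq_zero z hz]⟩
  rw [Pi.mul_apply, Pi.mul_apply]
  rcases le_total ‖w‖ R with hw | hw
  · exact hnear z w hw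
  rcases le_total ‖z‖ R with hz | hz
  · rw [norm_sub_rev, norm_sub_rev z]
    exact hnear w z hz
  · rw [hμ.eq_zero z hz, hμ.eq_zero w hw, zero_mul, zero_mul, sub_zero, norm_zero]
    positivity

theorem exists_eq_mul_one_add_beurling {A : ℝ} {μ : ℂ → ℂ} (hμ : HolderSupported α R A μ)
    (hα0 : 0 < α) (hα1 : α < 1) (hR : 0 ≤ R) (hμ0 : μ 0 = 0)
    (hsmall : A * R ^ α * beurlingConst α ≤ 1 / 4) :
    ∃ h, HolderSupported α R (2 * A) h ∧ ∀ z, h z = μ z * (1 + beurling h z) := by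
  have hA := hμ.nonneg
  obtain ⟨h, hh, hfix⟩ := exists_fixedPoint (α := α) (R := R) (N := 2 * A)
    (Φ := fun f => μ + μ * beurling f) (by positivity)
    (fun f hf => by
      convert hμ.add (hμ.mul_beurling hα0 hα1 hR hμ0 hf hsmall) using 1
      ring)
    (fun f g M hf hg hfg => by
      convert hμ.mul_beurling hα0 hα1 hR hμ0 hfg hsmall using 1
      funext z
      simp only [Pi.sub_apply, Pi.add_apply, Pi.mul_apply, hf.beurling_sub hg hα0]
      ring)
  refine ⟨h, hh, fun z => ?_⟩
  conv_lhs => rw [← hfix]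
  simp only [Pi.add_apply, Pi.mul_apply]
  ring

end HolderSupported

theorem isEmbedding_domRestrict_ball_of_hasFDerivAt {f : ℂ → ℂ} {a b : ℂ → ℂ} {R : ℝ}
    (hf : ∀ z, HasFDerivAt f (wirtingerCLM (1 + a z) (b z)) z)
    (hab : ∀ z ∈ ball (0 : ℂ) R, ‖a z‖ + ‖b z‖ ≤ 1 / 2) :
    Topology.IsEmbedding ((ball (0 : ℂ) R).domRestrict f) := by
  have hcont : Continuous f := continuous_iff_continuousAt.2 fun z => (hf z).continuousAt
  have hd : ∀ z, HasFDerivAt (fun z => f z - z) (wirtingerCLM (a z) (b z)) z := fun z => by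
    refine ((hf z).sub (hasFDerivAt_id z)).congr_fderiv ?_
    ext v
    simp only [sub_apply, wirtingerCLM_apply, ContinuousLinearMap.id_apply]
    ring
  have hanti : AntilipschitzWith 2 ((ball (0 : ℂ) R).domRestrict f) := by
    refine AntilipschitzWith.of_le_mul_dist fun z w => ?_
    have h1 := (convex_ball (0 : ℂ) R).norm_image_sub_le_of_norm_hasFDerivWithin_le
      (fun z _ => (hd z).hasFDerivWithinAt)
      (fun z hz => (norm_wirtingerCLM_le _ _).trans (hab z hz)) w.2 z.2
    have h2 := norm_sub_norm_le ((z : ℂ) - w) (f z - f w)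
    rw [show (z : ℂ) - w - (f z - f w) = -(f z - z - (f w - w)) by ring, norm_neg] at h2
    rw [Subtype.dist_eq, dist_eq_norm, dist_eq_norm]
    change ‖(z : ℂ) - w‖ ≤ 2 * ‖f z - f w‖
    linarith
  exact hanti.isEmbedding (hcont.comp continuous_subtype_val)

/-- **Theorem 5.2 (local solution for Hölder continuous `μ`; isothermal coordinates).**
For every `α ∈ (0,1)`, `A > 0` and `k ∈ [0,1)` there is `R₀ > 0` such that: whenever
`0 < R ≤ R₀` and `μ : ℂ → ℂ` is Hölder continuous with exponent `α` and constant `A`,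
compactly supported in `B(0,R)`, with `μ(0) = 0` and `‖μ‖_∞ ≤ k`, there is a `C¹` map
`f : B(0,R) → ℂ` solving `∂_z̄ f = μ ∂_z f` on `B(0,R)` with everywhere positive Jacobian
`J_f = |∂_z f|² - |∂_z̄ f|²`, which is a homeomorphism onto its image. -/
theorem isothermal_local_solution (α A k : ℝ) (hα0 : 0 < α) (hα1 : α < 1) (hA : 0 < A)
    (hk0 : 0 ≤ k) (hk1 : k < 1) :
    ∃ R₀ : ℝ, 0 < R₀ ∧
      ∀ R : ℝ, 0 < R → R ≤ R₀ →
      ∀ μ : ℂ → ℂ,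
        (∀ z₁ z₂ : ℂ, ‖μ z₁ - μ z₂‖ ≤ A * ‖z₁ - z₂‖ ^ α) →
        HasCompactSupport μ → tsupport μ ⊆ ball (0 : ℂ) R →
        μ 0 = 0 → (∀ z : ℂ, ‖μ z‖ ≤ k) →
        ∃ f : ℂ → ℂ,
          ContDiffOn ℝ 1 f (ball (0 : ℂ) R) ∧
          (∀ z ∈ ball (0 : ℂ) R, dZbar f z = μ z * dZ f z) ∧
          (∀ z ∈ ball (0 : ℂ) R, 0 < ‖dZ f z‖ ^ 2 - ‖dZbar f z‖ ^ 2) ∧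
          Topology.IsEmbedding ((ball (0 : ℂ) R).restrict f) := by
  have hC := beurlingConst_pos hα0 hα1
  set C := beurlingConst α with hCdef
  refine ⟨(1 / (8 * A * (C + 1))) ^ α⁻¹, by positivity, fun R hR hRR₀ μ hμ _ hsupp hμ0 hμk => ?_⟩
  have hRα : R ^ α ≤ 1 / (8 * A * (C + 1)) := by
    refine (Real.rpow_le_rpow hR.le hRR₀ hα0.le).trans_eq ?_
    rw [← Real.rpow_mul (by positivity), inv_mul_cancel₀ hα0.ne', Real.rpow_one]
  have hARC : A * R ^ α * (C + 1) ≤ 1 / 8 := by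
    rw [le_div_iff₀ (by positivity)] at hRα
    linarith
  have hAR : 0 < A * R ^ α := by positivity
  have hARC0 : 0 < A * R ^ α * C := by positivity
  have hsmall : A * R ^ α * C ≤ 1 / 8 := by linarith
  have hARle : A * R ^ α ≤ 1 / 8 := by linarith
  have Hμ : HolderSupported α R A μ := ⟨hμ, fun z hz => by
    refine image_eq_zero_of_notMem_tsupport fun h => ?_
    have := hsupp h
    rw [mem_ball_zero_iff] at this
    linarith⟩
  obtain ⟨h, Hh, hfix⟩ := Hμ.exists_eq_mul_one_add_beurling hα0 hα1 hR.le hμ0 (by linarith)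
  have hT : ∀ z ∈ ball (0 : ℂ) R, ‖beurling h z‖ ≤ 1 / 4 := fun z hz => by
    refine (Hh.norm_beurling_le hα0 hα1 (mem_ball_zero_iff.1 hz).le).trans ?_
    rw [← hCdef]
    linarith
  have hh : ∀ z ∈ ball (0 : ℂ) R, ‖h z‖ ≤ 1 / 4 := fun z hz => by
    have h1 := Hμ.norm_le_of_apply_zero hα0 hR.le hμ0 z
    have h2 : ‖1 + beurling h z‖ ≤ 1 + 1 / 4 :=
      (norm_add_le _ _).trans (by rw [norm_one]; linarith [hT z hz])
    rw [hfix, norm_mul]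
    exact (mul_le_mul (h1.trans hARle) h2 (norm_nonneg _) (by norm_num)).trans (by norm_num)
  let b₀ : ℂ := -(Real.pi : ℂ)⁻¹ * ∫ s in Ioi 0, kernelConv h (kerZ s) 0
  let f : ℂ → ℂ := fun z => (1 - b₀) * z + cauchyTransform h z
  have hf : ∀ z, HasFDerivAt f (wirtingerCLM (1 + beurling h z) (h z)) z := fun z => by
    refine (((hasFDerivAt_id z).const_mul (1 - b₀)).add
      (Hh.hasFDerivAt_cauchyTransform hα0 z)).congr_fderiv ?_
    ext v
    rw [beurling_eq Hh hα0 z]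
    simp only [add_apply, smul_apply,
      wirtingerCLM_apply, ContinuousLinearMap.id_apply, smul_eq_mul, b₀]
    ring
  have hTc : Continuous (beurling h) := continuous_of_holder hα0 (Hh.norm_beurling_sub_le hα0 hα1)
  refine ⟨f, ?_, fun z _ => ?_, fun z hz => ?_,
    isEmbedding_domRestrict_ball_of_hasFDerivAt hf fun z hz => by linarith [hT z hz, hh z hz]⟩
  · exact (contDiff_one_iff_hasFDerivAt.2 ⟨_, continuous_wirtingerCLM.comp
      ((continuous_const.add hTc).prodMk (Hh.continuous hα0)), hf⟩).contDiffOn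
  · rw [dZ_eq_of_hasFDerivAt (hf z), dZbar_eq_of_hasFDerivAt (hf z), hfix]
  · rw [dZ_eq_of_hasFDerivAt (hf z), dZbar_eq_of_hasFDerivAt (hf z), hfix, norm_mul, mul_pow]
    have h1 : 0 < ‖1 + beurling h z‖ := by
      have := norm_sub_norm_le (1 : ℂ) (-beurling h z)
      rw [norm_one, norm_neg, sub_neg_eq_add] at this
      linarith [hT z hz]
    have h2 : ‖μ z‖ ^ 2 < 1 :=
      pow_lt_one₀ (norm_nonneg _) ((hμk z).trans_lt hk1) two_ne_zero
    nlinarith [pow_pos h1 2]
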